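/- Let π : Γ → Δ be a tropical admissible cover with deg(π) = g(Γ) and Δ a metric tree. If y ∈ Γ satisfies d_π(y) = g(Γ), then y is a Weierstrass point of Γ. -/

import Mathlib

open scoped Classical

noncomputable section

/-! ## Combinatorial models of metric graphs and their topological realizations -/

/-- A combinatorial model of a metric graph: a finite multigraph with positive
edge lengths. -/
structure CombGraph : Type 1 where
  V : Type
  E : Type
  fintypeV : Fintype V
  fintypeE : Fintype E
  src : E → V
  tgt : E → V
  len : E → ℝ
  len_pos : ∀ e, 0 < len e

attribute [instance] CombGraph.fintypeV CombGraph.fintypeE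

namespace CombGraph

variable (G : CombGraph)

instance : TopologicalSpace G.V := ⊥
instance : TopologicalSpace G.E := ⊥

/-- The disjoint union of the vertices and of the edges seen as real intervals,
before gluing. -/
def Pre : Type := G.V ⊕ (G.E × ℝ)

instance : TopologicalSpace G.Pre := inferInstanceAs (TopologicalSpace (G.V ⊕ (G.E × ℝ)))

/-- The predicate selecting legitimate points: a point of an edge `e` must have its
coordinate in `[0, len e]`. -/
def Ok : G.Pre → Prop
  | Sum.inl _ => True
  | Sum.inr p => 0 ≤ p.2 ∧ p.2 ≤ G.len p.1

/-- Points of the model before gluing. -/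
def PreR : Type := {p : G.Pre // G.Ok p}

instance : TopologicalSpace G.PreR := inferInstanceAs (TopologicalSpace {p : G.Pre // G.Ok p})

/-- The gluing relation: the endpoints of each edge are glued to the corresponding
vertices. -/
inductive Glue : G.PreR → G.PreR → Prop
  | srcGlue (e : G.E) :
      Glue ⟨Sum.inl (G.src e), trivial⟩ ⟨Sum.inr (e, 0), ⟨le_refl 0, (G.len_pos e).le⟩⟩
  | tgtGlue (e : G.E) :
      Glue ⟨Sum.inl (G.tgt e), trivial⟩ ⟨Sum.inr (e, G.len e), ⟨(G.len_pos e).le, le_refl _⟩⟩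

/-- The topological realization of the combinatorial model: the underlying
topological space of the associated metric graph. -/
def Space : Type := Quot G.Glue

instance : TopologicalSpace G.Space := inferInstanceAs (TopologicalSpace (Quot G.Glue))

/-- The point of the realization corresponding to a vertex. -/
def vertexPt (v : G.V) : G.Space := Quot.mk _ ⟨Sum.inl v, trivial⟩

/-- Clamping of a real coordinate into `[0, len e]`. -/
def clamp (e : G.E) (t : ℝ) : ℝ := max 0 (min t (G.len e))

/-- The point of the realization lying on the edge `e` at coordinate `t`
(the coordinate is clamped into `[0, len e]`). -/
def edgePt (e : G.E) (t : ℝ) : G.Space :=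
  Quot.mk _ ⟨Sum.inr (e, G.clamp e t),
    ⟨le_max_left 0 _, max_le (G.len_pos e).le (min_le_right _ _)⟩⟩

/-- The genus (first Betti number) of the (connected) metric graph. -/
def genus : ℤ := (Fintype.card G.E : ℤ) - (Fintype.card G.V : ℤ) + 1

/-! ### Outgoing directions, valence -/

/-- `d = (e, b)` is an outgoing unit tangent direction at the point `x`:
if `b = true` it points in the direction of increasing coordinate on `e`, if
`b = false` in the direction of decreasing coordinate. -/
def IsDir (x : G.Space) (d : G.E × Bool) : Prop :=
  if d.2 then ∃ t, 0 ≤ t ∧ t < G.len d.1 ∧ x = G.edgePt d.1 t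
  else ∃ t, 0 < t ∧ t ≤ G.len d.1 ∧ x = G.edgePt d.1 t

/-- The (finite) set of outgoing directions at a point. -/
def dirSet (x : G.Space) : Finset (G.E × Bool) :=
  Finset.univ.filter fun d => G.IsDir x d

/-- The valence of a point of the realization: the number of outgoing
directions at that point. -/
def valence (x : G.Space) : ℕ := (G.dirSet x).card

/-- The coordinate on the edge `d.1` of a point `x` admitting `d` as an outgoing
direction. -/
def dirCoord (x : G.Space) (d : G.E × Bool) : ℝ :=
  if d.2 then
    (if h : ∃ t, 0 ≤ t ∧ t < G.len d.1 ∧ x = G.edgePt d.1 t then h.choose else 0)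
  else
    (if h : ∃ t, 0 < t ∧ t ≤ G.len d.1 ∧ x = G.edgePt d.1 t then h.choose else 0)

/-- The point at distance `u` from `x` in the outgoing direction `d`. -/
def dirPt (x : G.Space) (d : G.E × Bool) (u : ℝ) : G.Space :=
  G.edgePt d.1 (G.dirCoord x d + (if d.2 then u else -u))

end CombGraph

/-! ### Rational functions and divisors -/

/-- A function `g : [0, L] → ℝ` is piecewise integral affine if there is a finite
subdivision of `[0, L]` on whose pieces `g` is affine with integral slope. -/
def PWIntAffine (g : ℝ → ℝ) (L : ℝ) : Prop :=
  ∃ (n : ℕ) (t : ℕ → ℝ) (m : ℕ → ℤ) (b : ℕ → ℝ),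
    t 0 = 0 ∧ t n = L ∧ (∀ i, i < n → t i < t (i + 1)) ∧
    (∀ i, i < n → ∀ u, t i ≤ u → u ≤ t (i + 1) → g u = (m i : ℝ) * u + b i)

/-- A rational function on the metric graph realizing `G`: a continuous function
which is piecewise integral affine on every edge. -/
structure RatFn (G : CombGraph) where
  toFun : G.Space → ℝ
  continuous : Continuous toFun
  piecewise : ∀ e : G.E, PWIntAffine (fun t => toFun (G.edgePt e t)) (G.len e)

namespace CombGraph

variable (G : CombGraph)

/-- The right-hand slope of a rational function on the edge `e` at coordinate `t`. -/
def rightSlope (f : RatFn G) (e : G.E) (t : ℝ) : ℝ :=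
  derivWithin (fun u => f.toFun (G.edgePt e u)) (Set.Ici t) t

/-- The left-hand slope of a rational function on the edge `e` at coordinate `t`. -/
def leftSlope (f : RatFn G) (e : G.E) (t : ℝ) : ℝ :=
  derivWithin (fun u => f.toFun (G.edgePt e u)) (Set.Iic t) t

/-- The order of a rational function at a point: the sum of its outgoing slopes. -/
def ordAt (f : RatFn G) (x : G.Space) : ℝ :=
  if h : ∃ v : G.V, x = G.vertexPt v then
    ∑ e : G.E,
      ((if G.src e = h.choose then G.rightSlope f e 0 else 0)
        + (if G.tgt e = h.choose then -(G.leftSlope f e (G.len e)) else 0))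
  else if h2 : ∃ p : G.E × ℝ, 0 < p.2 ∧ p.2 < G.len p.1 ∧ x = G.edgePt p.1 p.2 then
    G.rightSlope f h2.choose.1 h2.choose.2 - G.leftSlope f h2.choose.1 h2.choose.2
  else 0

/-- The group of divisors of the metric graph: the free abelian group on the
points of the realization. -/
abbrev Div (G : CombGraph) : Type := G.Space →₀ ℤ

/-- The degree of a divisor. -/
def degDiv (D : Div G) : ℤ := D.sum fun _ n => n

/-- A divisor is effective if all of its coefficients are nonnegative. -/
def Effective (D : Div G) : Prop := ∀ x, 0 ≤ D x

/-- `D` is the principal divisor associated to the rational function `f`. -/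
def IsPrincipal (D : Div G) (f : RatFn G) : Prop := ∀ x, (D x : ℝ) = G.ordAt f x

/-- Two divisors are linearly equivalent if their difference is principal. -/
def LinEquiv (D D' : Div G) : Prop := ∃ f : RatFn G, G.IsPrincipal (D - D') f

/-- The Baker–Norine rank of a divisor: the largest integer `k` such that for every
effective divisor `E` of degree `k` the linear system `|D - E|` is nonempty.  (For
negative `k` the condition is vacuous, so the supremum is `-1` exactly when
`|D|` is empty.) -/
def Rk (D : Div G) : ℤ :=
  sSup {k : ℤ | ∀ E : Div G, G.Effective E → G.degDiv E = k →
    ∃ E' : Div G, G.Effective E' ∧ G.LinEquiv (D - E) E'}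

/-- A point of a metric graph is a Weierstrass point if `rk(g·[x]) ≥ 1`. -/
def IsWeierstrass (x : G.Space) : Prop :=
  1 ≤ G.Rk (G.genus • Finsupp.single x 1)

/-- The canonical divisor of a metric graph. -/
def canonical : Div G :=
  ∑ v : G.V, ((G.valence (G.vertexPt v) : ℤ) - 2) • Finsupp.single (G.vertexPt v) 1

end CombGraph
/-! ### Tropical admissible covers -/

/-- A tropical admissible cover between the metric graphs realizing `G` and `D`:
a continuous surjective map with finite fibers which is locally integral affine
(witnessed by the data of the image direction `dirMap` and the absolute value
`slope` of the integral slope along every outgoing direction), such that the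
local degree is well defined at every point, and all Riemann–Hurwitz numbers are
nonnegative. -/
structure TropCover (G D : CombGraph) where
  toFun : G.Space → D.Space
  continuous : Continuous toFun
  surjective : Function.Surjective toFun
  finiteFibers : ∀ y : D.Space, (toFun ⁻¹' {y}).Finite
  dirMap : G.Space → G.E × Bool → D.E × Bool
  slope : G.Space → G.E × Bool → ℕ
  localDeg : G.Space → ℕ
  dirMap_isDir : ∀ x d, G.IsDir x d → D.IsDir (toFun x) (dirMap x d)
  locAffine : ∀ x d, G.IsDir x d → ∃ ε > (0 : ℝ), ∀ u, 0 ≤ u → u ≤ ε →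
      toFun (G.dirPt x d u) = D.dirPt (toFun x) (dirMap x d) ((slope x d : ℝ) * u)
  localDeg_spec : ∀ x d', D.IsDir (toFun x) d' →
      localDeg x = ∑ d ∈ (G.dirSet x).filter (fun d => dirMap x d = d'), slope x d
  rh_nonneg : ∀ x, 0 ≤ (G.valence x : ℤ) - 2 - (localDeg x : ℤ) * ((D.valence (toFun x) : ℤ) - 2)

namespace TropCover

variable {G D : CombGraph} (π : TropCover G D)

/-- The fiber of a point as a finite set. -/
def fiber (y : D.Space) : Finset G.Space := (π.finiteFibers y).toFinset

/-- The pullback `π*[y]` of the divisor `[y]`. -/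
def fiberDiv (y : D.Space) : CombGraph.Div G :=
  ∑ z ∈ π.fiber y, (π.localDeg z : ℤ) • Finsupp.single z 1

/-- The pullback morphism on divisors. -/
def pullback (A : CombGraph.Div D) : CombGraph.Div G :=
  A.sum fun y n => n • π.fiberDiv y

/-- The pushforward morphism on divisors. -/
def pushforward (A : CombGraph.Div G) : CombGraph.Div D :=
  Finsupp.mapDomain π.toFun A

/-- The degree of the cover, computed at the point `y` of the target. -/
def degAt (y : D.Space) : ℕ := ∑ z ∈ π.fiber y, π.localDeg z

/-- The Riemann–Hurwitz number of the cover at a point of the source. -/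
def rhNum (x : G.Space) : ℤ :=
  (G.valence x : ℤ) - 2 - (π.localDeg x : ℤ) * ((D.valence (π.toFun x) : ℤ) - 2)

/-- The (finite) set of points where the ramification divisor may be supported:
the vertices of the source together with the fibers of the vertices of the target
(at every other point the Riemann–Hurwitz number vanishes). -/
def ramSupport : Finset G.Space :=
  Finset.univ.image G.vertexPt ∪
    Finset.univ.biUnion fun v : D.V => π.fiber (D.vertexPt v)

/-- The ramification divisor `R_π = Σ_x r_π(x)·[x]` of the cover. -/
def ramDiv : CombGraph.Div G :=
  ∑ x ∈ π.ramSupport, π.rhNum x • Finsupp.single x 1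

end TropCover

namespace CombGraph

variable (G : CombGraph)

instance : DiscreteTopology G.V := ⟨rfl⟩
instance : DiscreteTopology G.E := ⟨rfl⟩

/-- The normal form of a point: a vertex, or an edge with an interior coordinate. -/
def normalForm : G.Space → G.V ⊕ (G.E × ℝ) :=
  Quot.lift
    (fun p => Sum.elim Sum.inl
      (fun q : G.E × ℝ => if q.2 = 0 then Sum.inl (G.src q.1)
        else if q.2 = G.len q.1 then Sum.inl (G.tgt q.1) else Sum.inr q)
      (p.1 : G.V ⊕ (G.E × ℝ)))
    (by
      rintro _ _ (e | e)
      · simp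
      · simp [(G.len_pos e).ne'])

variable {G}

theorem normalForm_vertexPt (v : G.V) : G.normalForm (G.vertexPt v) = Sum.inl v := rfl

theorem clamp_of_mem {e : G.E} {t : ℝ} (h0 : 0 ≤ t) (h1 : t ≤ G.len e) : G.clamp e t = t := by
  simp [clamp, h0, h1]

theorem edgePt_eq_mk {e : G.E} {t : ℝ} (h0 : 0 ≤ t) (h1 : t ≤ G.len e) :
    G.edgePt e t = Quot.mk _ ⟨Sum.inr (e, t), ⟨h0, h1⟩⟩ := by
  unfold edgePt
  congr 3
  exact Prod.ext rfl (clamp_of_mem h0 h1)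

theorem edgePt_zero (e : G.E) : G.edgePt e 0 = G.vertexPt (G.src e) := by
  rw [edgePt_eq_mk le_rfl (G.len_pos e).le]
  exact (Quot.sound (Glue.srcGlue e)).symm

theorem edgePt_len (e : G.E) : G.edgePt e (G.len e) = G.vertexPt (G.tgt e) := by
  rw [edgePt_eq_mk (G.len_pos e).le le_rfl]
  exact (Quot.sound (Glue.tgtGlue e)).symm

theorem normalForm_edgePt {e : G.E} {t : ℝ} (h0 : 0 < t) (h1 : t < G.len e) :
    G.normalForm (G.edgePt e t) = Sum.inr (e, t) := by
  rw [edgePt_eq_mk h0.le h1.le]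
  simp [normalForm, h0.ne', h1.ne]

theorem exists_vertexPt_or_edgePt (x : G.Space) : (∃ v, x = G.vertexPt v) ∨
    ∃ e t, 0 < t ∧ t < G.len e ∧ x = G.edgePt e t := by
  obtain ⟨⟨p, hp⟩, rfl⟩ := Quot.exists_rep x
  rcases p with v | ⟨e, t⟩
  · exact Or.inl ⟨v, rfl⟩
  · obtain ⟨h0, h1⟩ : 0 ≤ t ∧ t ≤ G.len e := hp
    have hx := edgePt_eq_mk h0 h1
    rcases h0.eq_or_lt with rfl | h0'
    · exact Or.inl ⟨_, hx.symm.trans (edgePt_zero e)⟩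
    rcases h1.eq_or_lt with rfl | h1'
    · exact Or.inl ⟨_, hx.symm.trans (edgePt_len e)⟩
    exact Or.inr ⟨e, t, h0', h1', hx.symm⟩

theorem vertexPt_injective : Function.Injective G.vertexPt := fun v w h => by
  simpa [normalForm_vertexPt] using congrArg G.normalForm h

theorem edgePt_ne_vertexPt {e : G.E} {t : ℝ} (h0 : 0 < t) (h1 : t < G.len e) (v : G.V) :
    G.edgePt e t ≠ G.vertexPt v := fun h => by
  simpa [normalForm_vertexPt, normalForm_edgePt h0 h1] using congrArg G.normalForm h

theorem edgePt_inj {e e' : G.E} {t t' : ℝ} (h0 : 0 < t) (h1 : t < G.len e)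
    (h0' : 0 < t') (h1' : t' < G.len e') : G.edgePt e t = G.edgePt e' t' ↔ e = e' ∧ t = t' := by
  refine ⟨fun h => ?_, fun ⟨h, h'⟩ => by rw [h, h']⟩
  simpa [normalForm_edgePt h0' h1', normalForm_edgePt h0 h1] using congrArg G.normalForm h

theorem edgePt_injOn_Ico {e : G.E} {t s : ℝ} (h0 : 0 ≤ t) (h1 : t < G.len e) (h0' : 0 ≤ s)
    (h1' : s < G.len e) (h : G.edgePt e t = G.edgePt e s) : t = s := by
  rcases h0.eq_or_lt with rfl | h0
  · rcases h0'.eq_or_lt with rfl | h0'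
    · rfl
    · rw [edgePt_zero] at h
      exact absurd h.symm (edgePt_ne_vertexPt h0' h1' _)
  · rcases h0'.eq_or_lt with rfl | h0'
    · rw [edgePt_zero] at h
      exact absurd h (edgePt_ne_vertexPt h0 h1 _)
    · exact ((edgePt_inj h0 h1 h0' h1').1 h).2

theorem edgePt_injOn_Ioc {e : G.E} {t s : ℝ} (h0 : 0 < t) (h1 : t ≤ G.len e) (h0' : 0 < s)
    (h1' : s ≤ G.len e) (h : G.edgePt e t = G.edgePt e s) : t = s := by
  rcases h1.eq_or_lt with rfl | h1
  · rcases h1'.eq_or_lt with rfl | h1'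
    · rfl
    · rw [edgePt_len] at h
      exact absurd h.symm (edgePt_ne_vertexPt h0' h1' _)
  · rcases h1'.eq_or_lt with rfl | h1'
    · rw [edgePt_len] at h
      exact absurd h (edgePt_ne_vertexPt h0 h1 _)
    · exact ((edgePt_inj h0 h1 h0' h1').1 h).2

theorem isDir_true_iff {x : G.Space} {e : G.E} :
    G.IsDir x (e, true) ↔ ∃ t, 0 ≤ t ∧ t < G.len e ∧ x = G.edgePt e t := by
  simp [IsDir]

theorem isDir_false_iff {x : G.Space} {e : G.E} :
    G.IsDir x (e, false) ↔ ∃ t, 0 < t ∧ t ≤ G.len e ∧ x = G.edgePt e t := by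
  simp [IsDir]

theorem isDir_vertexPt_true {v : G.V} {e : G.E} :
    G.IsDir (G.vertexPt v) (e, true) ↔ G.src e = v := by
  rw [isDir_true_iff]
  constructor
  · rintro ⟨t, h0, h1, h⟩
    rcases h0.eq_or_lt with rfl | h0
    · rw [edgePt_zero] at h
      exact (vertexPt_injective h).symm
    · exact absurd h.symm (edgePt_ne_vertexPt h0 h1 _)
  · rintro rfl
    exact ⟨0, le_rfl, G.len_pos e, (edgePt_zero e).symm⟩

theorem isDir_vertexPt_false {v : G.V} {e : G.E} :
    G.IsDir (G.vertexPt v) (e, false) ↔ G.tgt e = v := by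
  rw [isDir_false_iff]
  constructor
  · rintro ⟨t, h0, h1, h⟩
    rcases h1.eq_or_lt with rfl | h1
    · rw [edgePt_len] at h
      exact (vertexPt_injective h).symm
    · exact absurd h.symm (edgePt_ne_vertexPt h0 h1 _)
  · rintro rfl
    exact ⟨G.len e, G.len_pos e, le_rfl, (edgePt_len e).symm⟩

theorem isDir_edgePt {e e' : G.E} {t : ℝ} (h0 : 0 < t) (h1 : t < G.len e) (b : Bool) :
    G.IsDir (G.edgePt e t) (e', b) ↔ e' = e := by
  cases b
  · rw [isDir_false_iff]
    constructor
    · rintro ⟨s, h0', h1', h⟩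
      rcases h1'.eq_or_lt with rfl | h1'
      · rw [edgePt_len] at h
        exact absurd h (edgePt_ne_vertexPt h0 h1 _)
      · exact ((edgePt_inj h0 h1 h0' h1').1 h).1.symm
    · rintro rfl
      exact ⟨t, h0, h1.le, rfl⟩
  · rw [isDir_true_iff]
    constructor
    · rintro ⟨s, h0', h1', h⟩
      rcases h0'.eq_or_lt with rfl | h0'
      · rw [edgePt_zero] at h
        exact absurd h (edgePt_ne_vertexPt h0 h1 _)
      · exact ((edgePt_inj h0 h1 h0' h1').1 h).1.symm
    · rintro rfl
      exact ⟨t, h0.le, h1, rfl⟩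

theorem dirPt_true {e : G.E} {t : ℝ} (h0 : 0 ≤ t) (h1 : t < G.len e) (u : ℝ) :
    G.dirPt (G.edgePt e t) (e, true) u = G.edgePt e (t + u) := by
  have h : ∃ s, 0 ≤ s ∧ s < G.len e ∧ G.edgePt e t = G.edgePt e s := ⟨t, h0, h1, rfl⟩
  have hs := h.choose_spec
  have : G.dirCoord (G.edgePt e t) (e, true) = h.choose := by simp [dirCoord, h]
  simp only [dirPt, this, ← edgePt_injOn_Ico h0 h1 hs.1 hs.2.1 hs.2.2, if_true]

theorem dirPt_false {e : G.E} {t : ℝ} (h0 : 0 < t) (h1 : t ≤ G.len e) (u : ℝ) :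
    G.dirPt (G.edgePt e t) (e, false) u = G.edgePt e (t - u) := by
  have h : ∃ s, 0 < s ∧ s ≤ G.len e ∧ G.edgePt e t = G.edgePt e s := ⟨t, h0, h1, rfl⟩
  have hs := h.choose_spec
  have : G.dirCoord (G.edgePt e t) (e, false) = h.choose := by simp [dirCoord, h]
  simp [dirPt, this, ← edgePt_injOn_Ioc h0 h1 hs.1 hs.2.1 hs.2.2, sub_eq_add_neg]

/-- A function on the vertices of a connected metric graph that takes equal values at the
endpoints of every edge is constant. -/
theorem eq_of_forall_src_eq_tgt [ConnectedSpace G.Space] {α : Type*} (φ : G.V → α)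
    (h : ∀ e, φ (G.src e) = φ (G.tgt e)) (v w : G.V) : φ v = φ w := by
  let _ : TopologicalSpace α := ⊥
  have : DiscreteTopology α := ⟨rfl⟩
  let F : G.Space → α := Quot.lift
    (fun p => Sum.elim φ (fun q : G.E × ℝ => φ (G.src q.1)) (p.1 : G.V ⊕ (G.E × ℝ)))
    (by
      rintro _ _ (e | e)
      · simp
      · simp [h])
  have hF : Continuous F := by
    refine continuous_quot_lift _ ?_
    have h1 : Continuous (Sum.elim φ (fun q : G.E × ℝ => φ (G.src q.1))) :=
      continuous_sumElim.2 ⟨continuous_of_discreteTopology,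
        (continuous_of_discreteTopology (f := fun e => φ (G.src e))).comp continuous_fst⟩
    exact h1.comp continuous_subtype_val
  exact PreconnectedSpace.constant inferInstance hF (x := G.vertexPt v) (y := G.vertexPt w)

theorem continuous_edgePt (e : G.E) : Continuous (G.edgePt e) := by
  refine continuous_quot_mk.comp (Continuous.subtype_mk ?_ _)
  refine continuous_inr.comp (Continuous.prodMk continuous_const ?_)
  unfold clamp
  fun_prop

end CombGraph

/-! ### One-sided germs of piecewise integral affine functions -/

/-- `g` is affine of slope `m` immediately to the right of `t`. -/
def RightGerm (g : ℝ → ℝ) (t m : ℝ) : Prop :=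
  ∃ ε > (0 : ℝ), ∀ u, 0 ≤ u → u ≤ ε → g (t + u) = g t + m * u

/-- `g` is affine of outgoing slope `m` immediately to the left of `t`. -/
def LeftGerm (g : ℝ → ℝ) (t m : ℝ) : Prop :=
  ∃ ε > (0 : ℝ), ∀ u, 0 ≤ u → u ≤ ε → g (t - u) = g t + m * u

theorem RightGerm.derivWithin_eq {g : ℝ → ℝ} {t m : ℝ} (h : RightGerm g t m) :
    derivWithin g (Set.Ici t) t = m := by
  obtain ⟨ε, hε, h⟩ := h
  have h1 : HasDerivWithinAt (fun u => g t + m * (u - t)) m (Set.Ici t) t := by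
    simpa using (((hasDerivAt_id t).sub_const t).const_mul m).const_add (g t) |>.hasDerivWithinAt
  refine (h1.congr_of_eventuallyEq ?_ (by simp)).derivWithin (uniqueDiffWithinAt_Ici t)
  filter_upwards [Icc_mem_nhdsGE (show t < t + ε by linarith)] with u hu
  simpa using h (u - t) (by linarith [hu.1]) (by linarith [hu.2])

theorem LeftGerm.derivWithin_eq {g : ℝ → ℝ} {t m : ℝ} (h : LeftGerm g t m) :
    derivWithin g (Set.Iic t) t = -m := by
  obtain ⟨ε, hε, h⟩ := h
  have h1 : HasDerivWithinAt (fun u => g t + -m * (u - t)) (-m) (Set.Iic t) t := by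
    simpa using
      (((hasDerivAt_id t).sub_const t).const_mul (-m)).const_add (g t) |>.hasDerivWithinAt
  refine (h1.congr_of_eventuallyEq ?_ (by simp)).derivWithin (uniqueDiffWithinAt_Iic t)
  filter_upwards [Icc_mem_nhdsLE (show t - ε < t by linarith)] with u hu
  have := h (t - u) (by linarith [hu.2]) (by linarith [hu.1])
  rw [sub_sub_cancel] at this
  rw [this]
  ring

theorem PWIntAffine.append {g : ℝ → ℝ} {a b : ℝ} (h : PWIntAffine g a) (hab : a < b) (m : ℤ)
    (c : ℝ) (hg : ∀ u, a ≤ u → u ≤ b → g u = m * u + c) : PWIntAffine g b := by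
  obtain ⟨n, t, k, d, h0, hn, hlt, haff⟩ := h
  refine ⟨n + 1, fun i => if i ≤ n then t i else b, fun i => if i < n then k i else m,
    fun i => if i < n then d i else c, by simpa using h0, by simp, fun i hi => ?_,
    fun i hi u hu hu' => ?_⟩
  · rcases (Nat.lt_succ_iff.1 hi).eq_or_lt with rfl | hi'
    · simpa [hn] using hab
    · simpa [hi'.le, Nat.succ_le_of_lt hi'] using hlt i hi'
  · rcases (Nat.lt_succ_iff.1 hi).eq_or_lt with rfl | hi'
    · simp only [le_refl, if_true, hn, Nat.not_succ_le_self, if_false] at hu hu'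
      simpa using hg u hu hu'
    · simp only [hi'.le, if_true, Nat.succ_le_of_lt hi'] at hu hu'
      simpa [hi'] using haff i hi' u hu hu'

theorem PWIntAffine.of_germs {g : ℝ → ℝ} {L : ℝ} (hL : 0 < L)
    (hr : ∀ t, 0 ≤ t → t < L → ∃ m : ℤ, RightGerm g t m)
    (hl : ∀ t, 0 < t → t ≤ L → ∃ m : ℤ, LeftGerm g t m) : PWIntAffine g L := by
  set S : Set ℝ := {t | 0 ≤ t ∧ t ≤ L ∧ PWIntAffine g t} with hS
  have h0 : (0 : ℝ) ∈ S :=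
    ⟨le_rfl, hL.le, 0, fun _ => 0, fun _ => 0, fun _ => 0, rfl, rfl, by simp, by simp⟩
  have hb : BddAbove S := ⟨L, fun t ht => ht.2.1⟩
  have hs0 : 0 ≤ sSup S := le_csSup hb h0
  have hsL : sSup S ≤ L := csSup_le ⟨0, h0⟩ fun t ht => ht.2.1
  have hs : sSup S ∈ S := by
    refine ⟨hs0, hsL, ?_⟩
    rcases hs0.eq_or_lt with h | h
    · rw [← h]
      exact h0.2.2
    obtain ⟨m, ε, hε, hm⟩ := hl _ h hsL
    obtain ⟨t, ht, hts⟩ := exists_lt_of_lt_csSup ⟨0, h0⟩ (show sSup S - ε < sSup S by linarith)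
    rcases (le_csSup hb ht).eq_or_lt with h | h
    · exact h ▸ ht.2.2
    refine ht.2.2.append h (-m) (g (sSup S) + m * sSup S) fun u hu hu' => ?_
    have := hm (sSup S - u) (by linarith) (by linarith)
    rw [sub_sub_cancel] at this
    rw [this]
    push_cast
    ring
  rcases hsL.eq_or_lt with h | h
  · exact h ▸ hs.2.2
  obtain ⟨m, ε, hε, hm⟩ := hr _ hs0 h
  have hlt : sSup S < min (sSup S + ε) L := lt_min (by linarith) h
  refine absurd (le_csSup hb ⟨hs0.trans hlt.le, min_le_right _ _, ?_⟩) (not_le.2 hlt)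
  refine hs.2.2.append hlt m (g (sSup S) - m * sSup S) fun u hu hu' => ?_
  have := hm (u - sSup S) (by linarith) (by linarith [min_le_left (sSup S + ε) L])
  rw [add_sub_cancel] at this
  rw [this]
  ring

theorem PWIntAffine.exists_rightGerm {g : ℝ → ℝ} {L : ℝ} (h : PWIntAffine g L) {t : ℝ}
    (h0 : 0 ≤ t) (h1 : t < L) : ∃ m : ℤ, RightGerm g t m := by
  obtain ⟨n, τ, m, b, hτ0, hτn, -, haff⟩ := h
  have hex : ∃ j, t < τ j := ⟨n, hτn ▸ h1⟩
  obtain ⟨i, hi⟩ : ∃ i, Nat.find hex = i + 1 := Nat.exists_eq_succ_of_ne_zero fun hz => by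
    have := Nat.find_spec hex
    rw [hz, hτ0] at this
    linarith
  have hlt : t < τ (i + 1) := hi ▸ Nat.find_spec hex
  have hle : τ i ≤ t := not_lt.1 (Nat.find_min hex (by omega))
  have hin : i < n := by
    have := Nat.find_min' hex (hτn ▸ h1 : t < τ n)
    omega
  refine ⟨m i, τ (i + 1) - t, by linarith, fun u hu hu' => ?_⟩
  rw [haff i hin _ (by linarith) (by linarith), haff i hin t hle hlt.le]
  ring

theorem PWIntAffine.exists_leftGerm {g : ℝ → ℝ} {L : ℝ} (h : PWIntAffine g L) {t : ℝ}
    (h0 : 0 < t) (h1 : t ≤ L) : ∃ m : ℤ, LeftGerm g t m := by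
  obtain ⟨n, τ, m, b, hτ0, hτn, -, haff⟩ := h
  have hex : ∃ j, t ≤ τ j := ⟨n, hτn ▸ h1⟩
  obtain ⟨i, hi⟩ : ∃ i, Nat.find hex = i + 1 := Nat.exists_eq_succ_of_ne_zero fun hz => by
    have := Nat.find_spec hex
    rw [hz, hτ0] at this
    linarith
  have hle : t ≤ τ (i + 1) := hi ▸ Nat.find_spec hex
  have hlt : τ i < t := not_le.1 (Nat.find_min hex (by omega))
  have hin : i < n := by
    have := Nat.find_min' hex (hτn ▸ h1 : t ≤ τ n)
    omega
  refine ⟨-m i, t - τ i, by linarith, fun u hu hu' => ?_⟩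
  rw [haff i hin _ (by linarith) (by linarith), haff i hin t hlt.le hle]
  push_cast
  ring

namespace CombGraph

variable {G : CombGraph}

/-! ### Outgoing slopes and orders -/

/-- `f` has slope `m` at `x` in the outgoing direction `d`. -/
def HasSlope (f : G.Space → ℝ) (x : G.Space) (d : G.E × Bool) (m : ℝ) : Prop :=
  ∃ ε > (0 : ℝ), ∀ u, 0 ≤ u → u ≤ ε → f (G.dirPt x d u) = f x + m * u

theorem hasSlope_true_iff {f : G.Space → ℝ} {e : G.E} {t m : ℝ} (h0 : 0 ≤ t)
    (h1 : t < G.len e) : HasSlope f (G.edgePt e t) (e, true) m ↔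
      RightGerm (fun u => f (G.edgePt e u)) t m := by
  simp only [HasSlope, RightGerm, dirPt_true h0 h1]

theorem hasSlope_false_iff {f : G.Space → ℝ} {e : G.E} {t m : ℝ} (h0 : 0 < t)
    (h1 : t ≤ G.len e) : HasSlope f (G.edgePt e t) (e, false) m ↔
      LeftGerm (fun u => f (G.edgePt e u)) t m := by
  simp only [HasSlope, LeftGerm, dirPt_false h0 h1]

theorem HasSlope.add {f g : G.Space → ℝ} {x : G.Space} {d : G.E × Bool} {m n : ℝ}
    (hf : HasSlope f x d m) (hg : HasSlope g x d n) : HasSlope (f + g) x d (m + n) := by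
  obtain ⟨ε, hε, hf⟩ := hf
  obtain ⟨δ, hδ, hg⟩ := hg
  refine ⟨min ε δ, lt_min hε hδ, fun u hu hu' => ?_⟩
  simp only [Pi.add_apply, hf u hu (hu'.trans (min_le_left _ _)),
    hg u hu (hu'.trans (min_le_right _ _))]
  ring

theorem HasSlope.neg {f : G.Space → ℝ} {x : G.Space} {d : G.E × Bool} {m : ℝ}
    (hf : HasSlope f x d m) : HasSlope (-f) x d (-m) := by
  obtain ⟨ε, hε, hf⟩ := hf
  refine ⟨ε, hε, fun u hu hu' => ?_⟩
  simp only [Pi.neg_apply, hf u hu hu']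
  ring

theorem exists_hasSlope (f : RatFn G) {x : G.Space} {d : G.E × Bool} (hd : G.IsDir x d) :
    ∃ m : ℤ, HasSlope f.toFun x d m := by
  obtain ⟨e, b⟩ := d
  cases b
  · obtain ⟨t, h0, h1, rfl⟩ := isDir_false_iff.1 hd
    simpa only [hasSlope_false_iff h0 h1] using (f.piecewise e).exists_leftGerm h0 h1
  · obtain ⟨t, h0, h1, rfl⟩ := isDir_true_iff.1 hd
    simpa only [hasSlope_true_iff h0 h1] using (f.piecewise e).exists_rightGerm h0 h1

/-- A continuous function with integral outgoing slopes is a rational function. -/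
def ratFnOfSlopes (f : G.Space → ℝ) (hf : Continuous f)
    (h : ∀ x d, G.IsDir x d → ∃ m : ℤ, HasSlope f x d m) : RatFn G where
  toFun := f
  continuous := hf
  piecewise e := PWIntAffine.of_germs (G.len_pos e)
    (fun t h0 h1 => by
      simpa only [hasSlope_true_iff h0 h1] using
        h (G.edgePt e t) (e, true) (isDir_true_iff.2 ⟨t, h0, h1, rfl⟩))
    (fun t h0 h1 => by
      simpa only [hasSlope_false_iff h0 h1] using
        h (G.edgePt e t) (e, false) (isDir_false_iff.2 ⟨t, h0, h1, rfl⟩))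

theorem mem_dirSet {x : G.Space} {d : G.E × Bool} : d ∈ G.dirSet x ↔ G.IsDir x d := by
  simp [dirSet]

theorem sum_dirSet_vertexPt (v : G.V) (s : G.E × Bool → ℝ) :
    ∑ d ∈ G.dirSet (G.vertexPt v), s d = ∑ e : G.E, ((if G.src e = v then s (e, true) else 0)
      + (if G.tgt e = v then s (e, false) else 0)) := by
  simp only [dirSet, Finset.sum_filter, Fintype.sum_prod_type, Fintype.sum_bool,
    isDir_vertexPt_true, isDir_vertexPt_false]

theorem sum_dirSet_edgePt {e : G.E} {t : ℝ} (h0 : 0 < t) (h1 : t < G.len e)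
    (s : G.E × Bool → ℝ) :
    ∑ d ∈ G.dirSet (G.edgePt e t), s d = s (e, true) + s (e, false) := by
  simp only [dirSet, Finset.sum_filter, Fintype.sum_prod_type, Fintype.sum_bool,
    isDir_edgePt h0 h1, Finset.sum_add_distrib, Finset.sum_ite_eq', Finset.mem_univ, if_true]

/-- The order of a rational function is the sum of its outgoing slopes. -/
theorem ordAt_eq_sum (f : RatFn G) (x : G.Space) (s : G.E × Bool → ℝ)
    (hs : ∀ d, G.IsDir x d → HasSlope f.toFun x d (s d)) :
    G.ordAt f x = ∑ d ∈ G.dirSet x, s d := by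
  rcases exists_vertexPt_or_edgePt x with ⟨v, rfl⟩ | ⟨e, t, h0, h1, rfl⟩
  · have h : ∃ w, G.vertexPt v = G.vertexPt w := ⟨v, rfl⟩
    have hv : h.choose = v := (vertexPt_injective h.choose_spec).symm
    rw [ordAt, dif_pos h, hv, sum_dirSet_vertexPt]
    refine Finset.sum_congr rfl fun e _ => ?_
    congr 1
    · split_ifs with he
      · have := hs (e, true) (isDir_vertexPt_true.2 he)
        rw [← he, ← edgePt_zero, hasSlope_true_iff le_rfl (G.len_pos e)] at this
        exact this.derivWithin_eq
      · rfl
    · split_ifs with he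
      · have := hs (e, false) (isDir_vertexPt_false.2 he)
        rw [← he, ← edgePt_len, hasSlope_false_iff (G.len_pos e) le_rfl] at this
        rw [leftSlope, this.derivWithin_eq, neg_neg]
      · rfl
  · have h : ¬ ∃ w, G.edgePt e t = G.vertexPt w := fun ⟨w, hw⟩ => edgePt_ne_vertexPt h0 h1 w hw
    have h' : ∃ p : G.E × ℝ, 0 < p.2 ∧ p.2 < G.len p.1 ∧ G.edgePt e t = G.edgePt p.1 p.2 :=
      ⟨(e, t), h0, h1, rfl⟩
    have hp : h'.choose = (e, t) := by
      have hc := h'.choose_spec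
      have := (edgePt_inj h0 h1 hc.1 hc.2.1).1 hc.2.2
      exact (Prod.ext this.1 this.2).symm
    rw [ordAt, dif_neg h, dif_pos h', hp, sum_dirSet_edgePt h0 h1]
    have hr := hs (e, true) ((isDir_edgePt h0 h1 _).2 rfl)
    have hl := hs (e, false) ((isDir_edgePt h0 h1 _).2 rfl)
    rw [hasSlope_true_iff h0.le h1] at hr
    rw [hasSlope_false_iff h0 h1.le] at hl
    rw [rightSlope, leftSlope, hr.derivWithin_eq, hl.derivWithin_eq, sub_neg_eq_add]

/-- Integral outgoing slopes of a rational function (zero along pairs that are not directions). -/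
def outSlope (f : RatFn G) (x : G.Space) (d : G.E × Bool) : ℤ :=
  if hd : G.IsDir x d then (exists_hasSlope f hd).choose else 0

theorem hasSlope_outSlope (f : RatFn G) {x : G.Space} {d : G.E × Bool} (hd : G.IsDir x d) :
    HasSlope f.toFun x d (outSlope f x d) := by
  rw [outSlope, dif_pos hd]
  exact (exists_hasSlope f hd).choose_spec

theorem ordAt_eq_sum_outSlope (f : RatFn G) (x : G.Space) :
    G.ordAt f x = ∑ d ∈ G.dirSet x, (outSlope f x d : ℝ) :=
  ordAt_eq_sum f x _ fun _ => hasSlope_outSlope f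

theorem exists_ordAt_add (f g : RatFn G) :
    ∃ h : RatFn G, ∀ x, G.ordAt h x = G.ordAt f x + G.ordAt g x := by
  refine ⟨ratFnOfSlopes (f.toFun + g.toFun) (f.continuous.add g.continuous) fun x d hd =>
    ⟨outSlope f x d + outSlope g x d, ?_⟩, fun x => ?_⟩
  · simpa using (hasSlope_outSlope f hd).add (hasSlope_outSlope g hd)
  · rw [ordAt_eq_sum _ x (fun d => (outSlope f x d : ℝ) + outSlope g x d) fun d hd =>
      (hasSlope_outSlope f hd).add (hasSlope_outSlope g hd), Finset.sum_add_distrib,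
      ordAt_eq_sum_outSlope, ordAt_eq_sum_outSlope]

theorem exists_ordAt_neg (f : RatFn G) :
    ∃ h : RatFn G, ∀ x, G.ordAt h x = -G.ordAt f x := by
  refine ⟨ratFnOfSlopes (-f.toFun) f.continuous.neg fun x d hd => ⟨-outSlope f x d, ?_⟩,
    fun x => ?_⟩
  · simpa using (hasSlope_outSlope f hd).neg
  · rw [ordAt_eq_sum _ x (fun d => -(outSlope f x d : ℝ)) fun d hd =>
      (hasSlope_outSlope f hd).neg, Finset.sum_neg_distrib, ordAt_eq_sum_outSlope]

end CombGraph

theorem eqOn_Icc_of_rightGerm_zero {g : ℝ → ℝ} (hg : Continuous g) {a b c : ℝ} (ha : g a = c)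
    (h : ∀ t, a ≤ t → t < b → g t = c → RightGerm g t 0) : ∀ t ∈ Set.Icc a b, g t = c := by
  have hcl : IsClosed {t | g t = c} := isClosed_eq hg continuous_const
  refine (hcl.inter isClosed_Icc).Icc_subset_of_forall_exists_gt ha fun t ht y hy => ?_
  obtain ⟨ε, hε, hu⟩ := h t ht.2.1 ht.2.2 ht.1
  have hy' : 0 < y - t := sub_pos.2 hy
  have hm : 0 < min ε (y - t) := lt_min hε hy'
  refine ⟨t + min ε (y - t), ?_, by linarith, by linarith [min_le_right ε (y - t)]⟩
  have := hu _ hm.le (min_le_left _ _)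
  rw [zero_mul, add_zero] at this
  exact this.trans ht.1

theorem eqOn_Icc_of_leftGerm_zero {g : ℝ → ℝ} (hg : Continuous g) {a b c : ℝ} (hb : g b = c)
    (h : ∀ t, a < t → t ≤ b → g t = c → LeftGerm g t 0) : ∀ t ∈ Set.Icc a b, g t = c := by
  intro t ht
  have := eqOn_Icc_of_rightGerm_zero (g := fun u => g (-u)) (a := -b) (b := -a) (c := c)
    (by fun_prop) (by simpa using hb) (fun u hu hu' hc => ?_) (-t)
    ⟨by linarith [ht.2], by linarith [ht.1]⟩
  · simpa using this
  · obtain ⟨ε, hε, hv⟩ := h (-u) (by linarith) (by linarith) hc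
    refine ⟨ε, hε, fun v h0 h1 => ?_⟩
    rw [← hv v h0 h1]
    ring_nf

namespace CombGraph

variable {G : CombGraph}

/-! ### The rank of a multiple of a point -/

/-- Minimum principle: a superharmonic rational function is harmonic. -/
theorem ordAt_eq_zero_of_nonpos [CompactSpace G.Space] [ConnectedSpace G.Space] (f : RatFn G)
    (hf : ∀ x, G.ordAt f x ≤ 0) (y : G.Space) : G.ordAt f y = 0 := by
  obtain ⟨x₀, -, hx₀⟩ := isCompact_univ.exists_isMinOn Set.univ_nonempty f.continuous.continuousOn
  have hmin : ∀ x, f.toFun x₀ ≤ f.toFun x := fun x => hx₀ (Set.mem_univ x)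
  set c := f.toFun x₀ with hc
  have hslope : ∀ x, f.toFun x = c → ∀ d, G.IsDir x d → HasSlope f.toFun x d 0 := by
    intro x hx
    have hnn : ∀ d ∈ G.dirSet x, (0 : ℝ) ≤ outSlope f x d := fun d hd => by
      obtain ⟨ε, hε, h⟩ := hasSlope_outSlope f (mem_dirSet.1 hd)
      have h1 := h ε hε.le le_rfl
      have h2 := hmin (G.dirPt x d ε)
      by_contra! hneg
      nlinarith
    have hsum : ∑ d ∈ G.dirSet x, (outSlope f x d : ℝ) = 0 :=
      le_antisymm (ordAt_eq_sum_outSlope f x ▸ hf x) (Finset.sum_nonneg hnn)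
    intro d hd
    rw [← (Finset.sum_eq_zero_iff_of_nonneg hnn).1 hsum d (mem_dirSet.2 hd)]
    exact hasSlope_outSlope f hd
  have hcont : ∀ e, Continuous fun u => f.toFun (G.edgePt e u) := fun e =>
    f.continuous.comp (continuous_edgePt e)
  have hup : ∀ e t, 0 ≤ t → f.toFun (G.edgePt e t) = c →
      ∀ s ∈ Set.Icc t (G.len e), f.toFun (G.edgePt e s) = c := fun e t h0 ht =>
    eqOn_Icc_of_rightGerm_zero (hcont e) ht fun u hu hu' huc =>
      (hasSlope_true_iff (h0.trans hu) hu').1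
        (hslope _ huc _ (isDir_true_iff.2 ⟨u, h0.trans hu, hu', rfl⟩))
  have hdown : ∀ e t, t ≤ G.len e → f.toFun (G.edgePt e t) = c →
      ∀ s ∈ Set.Icc 0 t, f.toFun (G.edgePt e s) = c := fun e t h0 ht =>
    eqOn_Icc_of_leftGerm_zero (hcont e) ht fun u hu hu' huc =>
      (hasSlope_false_iff hu (hu'.trans h0)).1
        (hslope _ huc _ (isDir_false_iff.2 ⟨u, hu, hu'.trans h0, rfl⟩))
  have hedge : ∀ e, (f.toFun (G.vertexPt (G.src e)) = c) = (f.toFun (G.vertexPt (G.tgt e)) = c) :=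
    fun e => by
      rw [← edgePt_zero, ← edgePt_len]
      exact propext ⟨fun h => hup e 0 le_rfl h _ ⟨(G.len_pos e).le, le_rfl⟩,
        fun h => hdown e _ le_rfl h _ ⟨le_rfl, (G.len_pos e).le⟩⟩
  have hv₀ : ∃ v, f.toFun (G.vertexPt v) = c := by
    rcases exists_vertexPt_or_edgePt x₀ with ⟨v, hv⟩ | ⟨e, t, h0, h1, hx⟩
    · exact ⟨v, by rw [hc, hv]⟩
    · refine ⟨G.tgt e, ?_⟩
      rw [← edgePt_len]
      exact hup e t h0.le (by rw [hc, hx]) _ ⟨h1.le, le_rfl⟩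
  obtain ⟨v₀, hv₀⟩ := hv₀
  have hv : ∀ v, f.toFun (G.vertexPt v) = c := fun v =>
    (eq_of_forall_src_eq_tgt (fun v => f.toFun (G.vertexPt v) = c) hedge v₀ v).mp hv₀
  have hy : f.toFun y = c := by
    rcases exists_vertexPt_or_edgePt y with ⟨v, rfl⟩ | ⟨e, t, h0, h1, rfl⟩
    · exact hv v
    · exact hup e 0 le_rfl (by rw [edgePt_zero]; exact hv _) _ ⟨h0.le, h1.le⟩
  rw [ordAt_eq_sum f y (fun _ => 0) (hslope y hy), Finset.sum_const_zero]

theorem eq_single_of_effective_of_degDiv_eq_one {E : Div G} (hE : G.Effective E)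
    (h : G.degDiv E = 1) : ∃ x, E = Finsupp.single x 1 := by
  obtain ⟨x, hx⟩ : ∃ x, E x ≠ 0 := by
    by_contra! h0
    have : E = 0 := Finsupp.ext h0
    simp [this, degDiv] at h
  have hpos : 1 ≤ E x := lt_of_le_of_ne (hE x) hx.symm
  refine ⟨x, sub_eq_zero.1 ?_⟩
  have heff : ∀ z, 0 ≤ (E - Finsupp.single x 1 : Div G) z := fun z => by
    rw [Finsupp.sub_apply, Finsupp.single_apply]
    split_ifs with hz
    · subst hz
      omega
    · simpa using hE z
  have hdeg : (E - Finsupp.single x 1 : Div G).sum (fun _ n => n) = 0 := by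
    rw [Finsupp.sum_sub_index (fun _ _ _ => rfl), Finsupp.sum_single_index rfl]
    exact sub_eq_zero.2 h
  ext z
  by_contra hz
  exact hz ((Finset.sum_eq_zero_iff_of_nonneg fun z _ => heff z).1 hdeg z
    (Finsupp.mem_support_iff.2 hz))

theorem one_le_Rk [CompactSpace G.Space] [ConnectedSpace G.Space] (n : ℤ) (y : G.Space)
    (h : ∀ x, ∃ E' : Div G, G.Effective E' ∧
      G.LinEquiv (n • Finsupp.single y 1 - Finsupp.single x 1) E') :
    1 ≤ G.Rk (n • Finsupp.single y 1) := by
  refine le_csSup ⟨max n 0, fun k hk => ?_⟩ fun E hE hdeg => ?_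
  · by_contra! hlt
    obtain ⟨hn, h0⟩ := max_lt_iff.1 hlt
    obtain ⟨E', hE', f, hf⟩ := hk (Finsupp.single y k)
      (fun z => by rw [Finsupp.single_apply]; split_ifs <;> omega)
      (by simp [degDiv])
    have hord : ∀ x, (n • Finsupp.single y 1 - Finsupp.single y k - E' : Div G) x
        = (if y = x then n - k else 0) - E' x := fun x => by
      simp only [Finsupp.sub_apply, Finsupp.smul_apply, Finsupp.single_apply]
      split_ifs <;> simp
    have hle : ∀ x, G.ordAt f x ≤ 0 := fun x => by
      rw [← hf x, hord x]
      have := hE' x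
      exact_mod_cast (by split_ifs <;> omega : (if y = x then n - k else 0) - E' x ≤ 0)
    have hy := ordAt_eq_zero_of_nonpos f hle y
    rw [← hf y, hord y, if_pos rfl] at hy
    have := hE' y
    norm_cast at hy
    omega
  · obtain ⟨x, rfl⟩ := eq_single_of_effective_of_degDiv_eq_one hE hdeg
    exact h x

/-! ### Linear equivalence of points on a metric tree -/

/-- On a metric tree, every function on the edges is the coboundary of a function on the
vertices. -/
theorem exists_potential [ConnectedSpace G.Space] (hG : G.genus = 0) (c : G.E → ℝ) :
    ∃ a : G.V → ℝ, ∀ e, a (G.tgt e) - a (G.src e) = c e := by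
  let δ : (G.V → ℝ) →ₗ[ℝ] (G.E → ℝ) :=
    { toFun := fun a e => a (G.tgt e) - a (G.src e)
      map_add' := fun a b => by ext; simp; ring
      map_smul' := fun r a => by ext; simp; ring }
  have hker : LinearMap.ker δ ≤ Submodule.span ℝ {fun _ => 1} := fun a ha => by
    rw [LinearMap.mem_ker] at ha
    have hconst := eq_of_forall_src_eq_tgt a fun e => (sub_eq_zero.1 (congrFun ha e)).symm
    rw [Submodule.mem_span_singleton]
    rcases isEmpty_or_nonempty G.V with h | ⟨⟨v⟩⟩
    · exact ⟨0, funext fun w => (h.false w).elim⟩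
    · exact ⟨a v, funext fun w => by simp [hconst v w]⟩
  have h1 : Module.finrank ℝ (LinearMap.ker δ) ≤ 1 :=
    (Submodule.finrank_mono hker).trans
      ((finrank_span_le_card _).trans (by simp))
  have h2 := δ.finrank_range_add_finrank_ker
  rw [Module.finrank_fintype_fun_eq_card] at h2
  have h3 : Module.finrank ℝ (LinearMap.range δ) = Module.finrank ℝ (G.E → ℝ) := by
    refine le_antisymm (Submodule.finrank_le _) ?_
    rw [Module.finrank_fintype_fun_eq_card]
    unfold genus at hG
    omega
  obtain ⟨a, ha⟩ := LinearMap.range_eq_top.1 (Submodule.eq_top_of_finrank_eq h3) c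
  exact ⟨a, congrFun ha⟩

/-- The function on a metric graph with prescribed values at the vertices and constant on every
edge, except for slope one on the part of `e₀` beyond coordinate `t₀`. -/
theorem exists_ramp (a : G.V → ℝ) (e₀ : G.E) (t₀ : ℝ) (h0 : 0 ≤ t₀) (h1 : t₀ < G.len e₀)
    (ha : ∀ e, a (G.tgt e) - a (G.src e) = if e = e₀ then G.len e₀ - t₀ else 0) :
    ∃ F : G.Space → ℝ, Continuous F ∧ ∀ e t, 0 ≤ t → t ≤ G.len e →
      F (G.edgePt e t) = a (G.src e) + if e = e₀ then max (t - t₀) 0 else 0 := by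
  let F : G.Space → ℝ := Quot.lift
    (fun p => Sum.elim a
      (fun q : G.E × ℝ => a (G.src q.1) + if q.1 = e₀ then max (q.2 - t₀) 0 else 0)
      (p.1 : G.V ⊕ (G.E × ℝ)))
    (by
      rintro _ _ (e | e)
      · simp [h0]
      · have := ha e
        by_cases he : e = e₀
        · subst he
          simp only [if_true] at this
          simp only [Sum.elim_inl, Sum.elim_inr, if_true, max_eq_left (sub_pos.2 h1).le]
          linarith
        · simp only [he, if_false] at this
          simp only [Sum.elim_inl, Sum.elim_inr, he, if_false]
          linarith)
  refine ⟨F, continuous_quot_lift _ ?_, fun e t ht ht' => ?_⟩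
  · have hc : Continuous (Sum.elim a
        (fun q : G.E × ℝ => a (G.src q.1) + if q.1 = e₀ then max (q.2 - t₀) 0 else 0)) := by
      refine continuous_sumElim.2 ⟨continuous_of_discreteTopology,
        continuous_prod_of_discrete_left.2 fun e => ?_⟩
      by_cases he : e = e₀ <;> simp only [he, if_true, if_false] <;> fun_prop
    exact hc.comp continuous_subtype_val
  · rw [edgePt_eq_mk ht ht']
    rfl

theorem exists_ordAt_edgePt_sub_tgt [ConnectedSpace G.Space] (hG : G.genus = 0) (e₀ : G.E)
    (t₀ : ℝ) (h0 : 0 ≤ t₀) (h1 : t₀ < G.len e₀) : ∃ h : RatFn G, ∀ x, G.ordAt h x =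
      (if x = G.edgePt e₀ t₀ then 1 else 0) - (if x = G.vertexPt (G.tgt e₀) then 1 else 0) := by
  obtain ⟨a, ha⟩ := exists_potential hG fun e => if e = e₀ then G.len e₀ - t₀ else 0
  obtain ⟨F, hF, hFe⟩ := exists_ramp a e₀ t₀ h0 h1 ha
  have hr : ∀ e t, 0 ≤ t → t < G.len e → HasSlope F (G.edgePt e t) (e, true)
      (if e = e₀ ∧ t₀ ≤ t then (1 : ℤ) else 0 : ℤ) := by
    intro e t ht ht'
    rw [hasSlope_true_iff ht ht']
    by_cases he : e = e₀
    · subst he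
      by_cases htt : t₀ ≤ t
      · refine ⟨G.len e - t, by linarith, fun u hu hu' => ?_⟩
        simp only [hFe e t ht ht'.le, hFe e (t + u) (by linarith) (by linarith), htt, if_true,
          and_true, max_eq_left (show 0 ≤ t - t₀ by linarith),
          max_eq_left (show 0 ≤ t + u - t₀ by linarith)]
        push_cast
        ring
      · rw [not_le] at htt
        refine ⟨t₀ - t, by linarith, fun u hu hu' => ?_⟩
        simp only [hFe e t ht ht'.le, hFe e (t + u) (by linarith) (by linarith), not_le.2 htt,
          if_true, and_false, if_false, max_eq_right (show t - t₀ ≤ 0 by linarith),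
          max_eq_right (show t + u - t₀ ≤ 0 by linarith)]
        simp
    · refine ⟨G.len e - t, by linarith, fun u hu hu' => ?_⟩
      simp [hFe e t ht ht'.le, hFe e (t + u) (by linarith) (by linarith), he]
  have hl : ∀ e t, 0 < t → t ≤ G.len e → HasSlope F (G.edgePt e t) (e, false)
      (if e = e₀ ∧ t₀ < t then (-1 : ℤ) else 0 : ℤ) := by
    intro e t ht ht'
    rw [hasSlope_false_iff ht ht']
    by_cases he : e = e₀
    · subst he
      by_cases htt : t₀ < t
      · refine ⟨t - t₀, by linarith, fun u hu hu' => ?_⟩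
        simp only [hFe e t ht.le ht', hFe e (t - u) (by linarith) (by linarith), htt, if_true,
          and_true, max_eq_left (show 0 ≤ t - t₀ by linarith),
          max_eq_left (show 0 ≤ t - u - t₀ by linarith)]
        push_cast
        ring
      · rw [not_lt] at htt
        refine ⟨t, ht, fun u hu hu' => ?_⟩
        simp only [hFe e t ht.le ht', hFe e (t - u) (by linarith) (by linarith), not_lt.2 htt,
          if_true, and_false, if_false, max_eq_right (show t - t₀ ≤ 0 by linarith),
          max_eq_right (show t - u - t₀ ≤ 0 by linarith)]
        simp
    · refine ⟨t, ht, fun u hu hu' => ?_⟩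
      simp [hFe e t ht.le ht', hFe e (t - u) (by linarith) (by linarith), he]
  refine ⟨ratFnOfSlopes F hF ?_, fun x => ?_⟩
  · rintro x ⟨e, b⟩ hd
    cases b
    · obtain ⟨t, ht, ht', rfl⟩ := isDir_false_iff.1 hd
      exact ⟨_, hl e t ht ht'⟩
    · obtain ⟨t, ht, ht', rfl⟩ := isDir_true_iff.1 hd
      exact ⟨_, hr e t ht ht'⟩
  rcases exists_vertexPt_or_edgePt x with ⟨v, rfl⟩ | ⟨e, t, ht, ht', rfl⟩
  · rw [ordAt_eq_sum _ _ (fun d => if d.2 then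
      ((if d.1 = e₀ ∧ t₀ ≤ 0 then (1 : ℤ) else 0 : ℤ) : ℝ)
      else ((if d.1 = e₀ ∧ t₀ < G.len d.1 then (-1 : ℤ) else 0 : ℤ) : ℝ)), sum_dirSet_vertexPt,
      Finset.sum_eq_single e₀]
    · have hsrc : G.vertexPt v = G.edgePt e₀ t₀ ↔ t₀ ≤ 0 ∧ G.src e₀ = v := by
        rcases h0.eq_or_lt with rfl | h0'
        · rw [edgePt_zero, vertexPt_injective.eq_iff, eq_comm]
          simp
        · simp [(edgePt_ne_vertexPt h0' h1 v).symm, h0'.not_ge]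
      rw [hsrc, vertexPt_injective.eq_iff, eq_comm (a := v)]
      by_cases hA : t₀ ≤ 0 <;> by_cases hB : G.src e₀ = v <;> by_cases hC : G.tgt e₀ = v <;>
        simp [hA, hB, hC, h1]
    · intro e _ he
      simp [he]
    · simp
    · rintro ⟨e, b⟩ hd
      cases b
      · rw [isDir_vertexPt_false] at hd
        subst hd
        rw [← edgePt_len]
        exact hl e _ (G.len_pos e) le_rfl
      · rw [isDir_vertexPt_true] at hd
        subst hd
        rw [← edgePt_zero]
        exact hr e _ le_rfl (G.len_pos e)
  · rw [ordAt_eq_sum _ _ (fun d => if d.2 then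
      ((if d.1 = e₀ ∧ t₀ ≤ t then (1 : ℤ) else 0 : ℤ) : ℝ)
      else ((if d.1 = e₀ ∧ t₀ < t then (-1 : ℤ) else 0 : ℤ) : ℝ)), sum_dirSet_edgePt ht ht']
    · have hpt : G.edgePt e t = G.edgePt e₀ t₀ ↔ e = e₀ ∧ t = t₀ := by
        rcases h0.eq_or_lt with rfl | h0'
        · simp [edgePt_zero, edgePt_ne_vertexPt ht ht', ht.ne']
        · exact edgePt_inj ht ht' h0' h1
      rw [hpt, if_neg (edgePt_ne_vertexPt ht ht' _)]
      by_cases he : e = e₀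
      · rcases lt_trichotomy t t₀ with h | rfl | h
        · simp [he, h.ne, h.not_ge, h.not_gt]
        · simp [he]
        · simp [he, h.ne', h.le, h]
      · simp [he]
    · rintro ⟨e', b⟩ hd
      obtain rfl := (isDir_edgePt ht ht' b).1 hd
      cases b
      · exact hl e' t ht ht'.le
      · exact hr e' t ht.le ht'

/-- Any two points of a metric tree are linearly equivalent. -/
theorem exists_ordAt_sub_of_genus_eq_zero [ConnectedSpace G.Space] (hG : G.genus = 0)
    (p q : G.Space) : ∃ h : RatFn G, ∀ x, G.ordAt h x =
      (if x = p then 1 else 0) - (if x = q then 1 else 0) := by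
  let R : G.Space → G.Space → Prop := fun p q => ∃ h : RatFn G, ∀ x, G.ordAt h x =
    (if x = p then 1 else 0) - (if x = q then 1 else 0)
  have hsymm : ∀ {p q}, R p q → R q p := fun ⟨h, hh⟩ => by
    obtain ⟨k, hk⟩ := exists_ordAt_neg h
    exact ⟨k, fun x => by rw [hk, hh]; ring⟩
  have htrans : ∀ {p q r}, R p q → R q r → R p r := fun ⟨h, hh⟩ ⟨k, hk⟩ => by
    obtain ⟨l, hl⟩ := exists_ordAt_add h k
    exact ⟨l, fun x => by rw [hl, hh, hk]; ring⟩
  have hedge : ∀ e t, 0 ≤ t → t < G.len e → R (G.edgePt e t) (G.vertexPt (G.tgt e)) :=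
    exists_ordAt_edgePt_sub_tgt hG
  have hst : ∀ e, R (G.vertexPt (G.src e)) (G.vertexPt (G.tgt e)) := fun e =>
    edgePt_zero e ▸ hedge e 0 le_rfl (G.len_pos e)
  have hrefl : ∀ p, R p p := fun p =>
    ⟨ratFnOfSlopes (fun _ => 0) continuous_const fun _ _ _ => ⟨0, 1, one_pos, by simp⟩,
      fun x => by
        rw [ordAt_eq_sum _ x (fun _ => 0) fun _ _ => ⟨1, one_pos, by simp [ratFnOfSlopes]⟩]
        simp⟩
  have hvert : ∀ v w, R (G.vertexPt v) (G.vertexPt w) := fun v w =>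
    (eq_of_forall_src_eq_tgt (fun w => R (G.vertexPt v) (G.vertexPt w))
      (fun e => propext ⟨fun h => htrans h (hst e), fun h => htrans h (hsymm (hst e))⟩)
      v w).mp (hrefl _)
  have hex : ∀ p, ∃ v, R p (G.vertexPt v) := fun p => by
    rcases exists_vertexPt_or_edgePt p with ⟨v, rfl⟩ | ⟨e, t, h0, h1, rfl⟩
    · exact ⟨v, hrefl _⟩
    · exact ⟨_, hedge e t h0.le h1⟩
  obtain ⟨v, hv⟩ := hex p
  obtain ⟨w, hw⟩ := hex q
  exact htrans hv (htrans (hvert v w) (hsymm hw))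

end CombGraph

/-! ### Pulling back rational functions along a tropical admissible cover -/

namespace TropCover

open CombGraph

variable {G D : CombGraph} (π : TropCover G D)

theorem hasSlope_comp (h : RatFn D) {x : G.Space} {d : G.E × Bool} (hd : G.IsDir x d) :
    HasSlope (h.toFun ∘ π.toFun) x d
      ((π.slope x d : ℝ) * outSlope h (π.toFun x) (π.dirMap x d)) := by
  obtain ⟨ε, hε, hπ⟩ := π.locAffine x d hd
  obtain ⟨η, hη, hh⟩ := hasSlope_outSlope h (π.dirMap_isDir x d hd)
  have hs : (0 : ℝ) ≤ π.slope x d := Nat.cast_nonneg _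
  refine ⟨min ε (η / (π.slope x d + 1)), by positivity, fun u hu hu' => ?_⟩
  have hu2 : u * (π.slope x d + 1) ≤ η :=
    (le_div_iff₀ (by positivity)).1 (hu'.trans (min_le_right _ _))
  simp only [Function.comp_apply]
  rw [hπ u hu (hu'.trans (min_le_left _ _)), hh _ (by positivity) (by nlinarith)]
  ring

theorem exists_ordAt_comp (h : RatFn D) : ∃ f : RatFn G, ∀ x,
    G.ordAt f x = π.localDeg x * D.ordAt h (π.toFun x) := by
  refine ⟨ratFnOfSlopes (h.toFun ∘ π.toFun) (h.continuous.comp π.continuous) fun x d hd =>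
    ⟨π.slope x d * outSlope h (π.toFun x) (π.dirMap x d), ?_⟩, fun x => ?_⟩
  · simpa using π.hasSlope_comp h hd
  · rw [ordAt_eq_sum _ x _ fun d hd => π.hasSlope_comp h hd, ordAt_eq_sum_outSlope,
      Finset.mul_sum, ← Finset.sum_fiberwise_of_maps_to (t := D.dirSet (π.toFun x))
        (g := π.dirMap x) fun d hd => mem_dirSet.2 (π.dirMap_isDir x d (mem_dirSet.1 hd))]
    refine Finset.sum_congr rfl fun d' hd' => ?_
    rw [π.localDeg_spec x d' (mem_dirSet.1 hd')]
    push_cast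
    rw [Finset.sum_mul]
    refine Finset.sum_congr rfl fun d hd => ?_
    rw [(Finset.mem_filter.1 hd).2]

theorem slope_ne_zero {x : G.Space} {d : G.E × Bool} (hd : G.IsDir x d) : π.slope x d ≠ 0 := by
  intro h0
  obtain ⟨ε, hε, hπ⟩ := π.locAffine x d hd
  simp only [h0, Nat.cast_zero, zero_mul] at hπ
  set y := D.dirPt (π.toFun x) (π.dirMap x d) 0
  obtain ⟨r, hr, hrε, hinj⟩ : ∃ r > 0, r ≤ ε ∧ Set.InjOn (G.dirPt x d) (Set.Ioo 0 r) := by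
    obtain ⟨e, b⟩ := d
    cases b
    · obtain ⟨t, ht, ht', rfl⟩ := isDir_false_iff.1 hd
      refine ⟨min ε t, lt_min hε ht, min_le_left _ _, fun u hu v hv huv => ?_⟩
      rw [dirPt_false ht ht', dirPt_false ht ht'] at huv
      have hu2 := hu.2.trans_le (min_le_right _ _)
      have hv2 := hv.2.trans_le (min_le_right _ _)
      have := edgePt_injOn_Ioc (by linarith) (by linarith [hu.1]) (by linarith)
        (by linarith [hv.1]) huv
      linarith
    · obtain ⟨t, ht, ht', rfl⟩ := isDir_true_iff.1 hd
      refine ⟨min ε (G.len e - t), lt_min hε (by linarith), min_le_left _ _,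
        fun u hu v hv huv => ?_⟩
      rw [dirPt_true ht ht', dirPt_true ht ht'] at huv
      have hu2 := hu.2.trans_le (min_le_right _ _)
      have hv2 := hv.2.trans_le (min_le_right _ _)
      have := edgePt_injOn_Ico (by linarith [hu.1]) (by linarith) (by linarith [hv.1])
        (by linarith) huv
      linarith
  refine (Set.infinite_of_injOn_mapsTo hinj (t := π.toFun ⁻¹' {y}) (fun u hu => ?_)
    (Set.Ioo_infinite hr)) (π.finiteFibers y)
  exact hπ u hu.1.le (hu.2.le.trans hrε)

theorem one_le_localDeg (x : G.Space) : 1 ≤ π.localDeg x := by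
  by_cases hd : ∃ d, G.IsDir x d
  · obtain ⟨d, hd⟩ := hd
    rw [π.localDeg_spec x _ (π.dirMap_isDir x d hd)]
    exact (Nat.one_le_iff_ne_zero.2 (π.slope_ne_zero hd)).trans
      (Finset.single_le_sum (f := π.slope x) (fun _ _ => Nat.zero_le _)
        (Finset.mem_filter.2 ⟨mem_dirSet.2 hd, rfl⟩))
  · have hG : G.dirSet x = ∅ := Finset.eq_empty_of_forall_notMem fun d h =>
      hd ⟨d, mem_dirSet.1 h⟩
    have hrh := π.rh_nonneg x
    by_contra! h0
    simp [valence, hG, Nat.lt_one_iff.1 h0] at hrh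

/-- If the local degree at `y` is the full degree, then `y` is alone in its fiber. -/
theorem eq_of_localDeg_eq_degAt {y z : G.Space} (hy : π.localDeg y = π.degAt (π.toFun y))
    (hz : π.toFun z = π.toFun y) : z = y := by
  by_contra hne
  have hmem : ∀ {w}, π.toFun w = π.toFun y → w ∈ π.fiber (π.toFun y) := fun h => by
    simpa [fiber] using h
  have hsum := Finset.sum_le_sum_of_subset (f := π.localDeg) (s := {y, z})
    (t := π.fiber (π.toFun y)) fun w hw => by
      rcases Finset.mem_insert.1 hw with rfl | hw
      · exact hmem rfl
      · rw [Finset.mem_singleton.1 hw]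
        exact hmem hz
  rw [Finset.sum_pair (Ne.symm hne)] at hsum
  have := π.one_le_localDeg z
  unfold degAt at hy
  omega

theorem fiberDiv_apply (q : D.Space) (z : G.Space) :
    π.fiberDiv q z = if π.toFun z = q then (π.localDeg z : ℤ) else 0 := by
  simp [fiberDiv, fiber, Finsupp.finsetSum_apply, Finsupp.single_apply]

end TropCover

/-- Statement 14: if `π : Γ → Δ` is a tropical admissible cover of degree `g(Γ)` onto
a metric tree and `y ∈ Γ` has local degree `g(Γ)`, then `y` is a Weierstrass point. -/
theorem weierstrass_of_full_local_degree (Γ Δ : CombGraph)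
    (hΓc : CompactSpace Γ.Space) (hΓ : ConnectedSpace Γ.Space)
    (hΔc : CompactSpace Δ.Space) (hΔ : ConnectedSpace Δ.Space)
    (π : TropCover Γ Δ)
    (hdeg : ∀ x : Δ.Space, (π.degAt x : ℤ) = Γ.genus)
    (htree : Δ.genus = 0)
    (y : Γ.Space) (hy : (π.localDeg y : ℤ) = Γ.genus) :
    Γ.IsWeierstrass y := by
  have hdeg' : π.localDeg y = π.degAt (π.toFun y) := by
    exact_mod_cast hy.trans (hdeg (π.toFun y)).symm
  refine CombGraph.one_le_Rk _ y fun x => ?_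
  obtain ⟨h, hh⟩ := CombGraph.exists_ordAt_sub_of_genus_eq_zero htree (π.toFun y) (π.toFun x)
  obtain ⟨f, hf⟩ := π.exists_ordAt_comp h
  refine ⟨π.fiberDiv (π.toFun x) - Finsupp.single x 1, fun z => ?_, f, fun z => ?_⟩
  · rw [Finsupp.sub_apply, π.fiberDiv_apply, Finsupp.single_apply]
    have := π.one_le_localDeg z
    by_cases hz : x = z
    · subst hz
      simp
      omega
    · simp only [hz, if_false, sub_zero]
      split_ifs <;> omega
  · have hfib : π.toFun z = π.toFun y ↔ y = z :=
      ⟨fun hz => (π.eq_of_localDeg_eq_degAt hdeg' hz).symm, fun hz => by rw [hz]⟩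
    rw [hf, hh, sub_sub_sub_cancel_right, Finsupp.sub_apply, π.fiberDiv_apply,
      Finsupp.smul_apply, Finsupp.single_apply, ← hy]
    simp only [hfib]
    by_cases hz : y = z
    · subst hz
      by_cases hx : π.toFun y = π.toFun x <;> simp [hx]
    · by_cases hx : π.toFun z = π.toFun x <;> simp [hz, hx]
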